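/- arXiv:2207.04232 — 2 statements merged into one kernel-verified Lean document; each statement's English description precedes it below -/
import Mathlib

section
/- Let q = r^{sm} where r is an odd prime power, m is an odd positive integer and s is a positive integer. Let t be an even integer with t dividing r−1 and 1 ≤ t < r−1, and let e be an integer with 0 ≤ e ≤ s−1. If either η(t) = η(−1) = 1, or η(−t) = 1 and e is even, then there exists an MDS self-dual code over F_q of length (t+1)·r^e·(1 + r^s + r^{2s} + ⋯ + r^{s(m−1)}) + 1. -/
open Finset

/-- The Euclidean dual of a linear code `C ⊆ F^n`. -/
def euclideanDual {F : Type*} [Field F] {n : ℕ} (C : Submodule F (Fin n → F)) :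
    Submodule F (Fin n → F) where
  carrier := {x | ∀ c ∈ C, ∑ i, x i * c i = 0}
  add_mem' := by
    intro a b ha hb c hc
    have h : ∑ i, (a + b) i * c i = (∑ i, a i * c i) + ∑ i, b i * c i := by
      rw [← Finset.sum_add_distrib]
      exact Finset.sum_congr rfl fun i _ => by simp [add_mul]
    simp only [Set.mem_setOf_eq] at *
    rw [h, ha c hc, hb c hc, add_zero]
  zero_mem' := by
    intro c hc
    simp
  smul_mem' := by
    intro r a ha c hc
    have h : ∑ i, (r • a) i * c i = r * ∑ i, a i * c i := by
      rw [Finset.mul_sum]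
      exact Finset.sum_congr rfl fun i _ => by simp [mul_assoc]
    simp only [Set.mem_setOf_eq] at *
    rw [h, ha c hc, mul_zero]

/-- Hamming weight of a word. -/
noncomputable def hWeight {F : Type*} [Field F] {n : ℕ} (c : Fin n → F) : ℕ := Nat.card {i : Fin n // c i ≠ 0}

/-- `C` is an MDS (Euclidean) self-dual code: it equals its Euclidean dual and its
minimum Hamming distance is `n/2 + 1`. -/
def IsMDSSelfDual {F : Type*} [Field F] {n : ℕ} (C : Submodule F (Fin n → F)) : Prop :=
  C = euclideanDual C ∧
  (∀ c ∈ C, c ≠ 0 → n / 2 + 1 ≤ hWeight c) ∧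
  (∃ c ∈ C, c ≠ 0 ∧ hWeight c = n / 2 + 1)

open Classical in
/-- The quadratic character `η` of a field: `1` on nonzero squares, `-1` on nonsquares,
`0` at `0`. -/
noncomputable def quadChar (F : Type*) [Field F] (x : F) : ℤ :=
  if x = 0 then 0 else if IsSquare x then 1 else -1

open Polynomial in
/-- The evaluation map whose restriction to polynomials of degree less than `k` has as image an
extended generalized Reed-Solomon code; the coordinate `0` is the point at infinity. -/
noncomputable def extendedEval {F : Type*} [Field F] {n : ℕ} (k : ℕ) (a v : Fin n → F) :
    F[X] →ₗ[F] (Fin (n + 1) → F) where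
  toFun f := Fin.cons (f.coeff (k - 1)) fun i => v i * f.eval (a i)
  map_add' f g := by
    ext i
    refine Fin.cases ?_ (fun i => ?_) i <;> simp [mul_add]
  map_smul' c f := by
    ext i
    refine Fin.cases ?_ (fun i => ?_) i <;> simp [mul_left_comm]

section ExtendedReedSolomon

open Polynomial

variable {F : Type*} [Field F] {n k : ℕ} {a v : Fin n → F}

lemma hWeight_add_card_zeros [DecidableEq F] (c : Fin n → F) :
    hWeight c + #{i | c i = 0} = n := by
  have := card_filter_add_card_filter_not (s := (univ : Finset (Fin n))) fun i => c i = 0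
  rw [card_univ, Fintype.card_fin] at this
  rw [hWeight, Nat.card_eq_fintype_card, Fintype.card_subtype, add_comm]
  exact this

lemma card_zeros_extendedEval [DecidableEq F] (hv : ∀ i, v i ≠ 0) (f : F[X]) :
    #{i | extendedEval k a v f i = 0} =
      (if f.coeff (k - 1) = 0 then 1 else 0) + #{i | f.eval (a i) = 0} := by
  rw [Fin.card_filter_univ_succ]
  split_ifs <;> simp_all [extendedEval, add_comm]

lemma card_eval_eq_zero_le [DecidableEq F] (ha : Function.Injective a) {f : F[X]} (hf : f ≠ 0) :
    #{i | f.eval (a i) = 0} ≤ f.natDegree := by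
  rw [← card_image_of_injective _ ha]
  refine (card_le_card (t := f.roots.toFinset) ?_).trans
    ((Multiset.toFinset_card_le _).trans (card_roots' f))
  intro x hx
  obtain ⟨i, hi, rfl⟩ := mem_image.1 hx
  simpa [hf] using hi

lemma le_hWeight_extendedEval (hnk : n + 1 = 2 * k) (ha : Function.Injective a)
    (hv : ∀ i, v i ≠ 0) {f : F[X]} (hf : f ≠ 0) (hfk : f ∈ degreeLT F k) :
    k + 1 ≤ hWeight (extendedEval k a v f) := by
  classical
  have h1 := hWeight_add_card_zeros (extendedEval k a v f)
  rw [card_zeros_extendedEval hv] at h1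
  have h2 := card_eval_eq_zero_le ha hf
  have h3 : f.natDegree < k := (natDegree_lt_iff_degree_lt hf).2 (mem_degreeLT.1 hfk)
  split_ifs at h1 with h0
  · have : f.natDegree ≠ k - 1 := fun h => hf (leadingCoeff_eq_zero.1 (by rwa [leadingCoeff, h]))
    omega
  · omega

lemma exists_hWeight_extendedEval_le (hnk : n + 1 = 2 * k) (hv : ∀ i, v i ≠ 0) :
    ∃ f ∈ degreeLT F k, f ≠ 0 ∧ hWeight (extendedEval k a v f) ≤ k + 1 := by
  classical
  obtain ⟨T, -, hT⟩ := exists_subset_card_eq (s := (univ : Finset (Fin n))) (n := k - 1)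
    (by rw [card_univ, Fintype.card_fin]; omega)
  have hdeg : (Lagrange.nodal T a).degree = ((k - 1 : ℕ) : WithBot ℕ) := by
    rw [Lagrange.degree_nodal, hT]
  refine ⟨Lagrange.nodal T a, ?_, Lagrange.nodal_ne_zero, ?_⟩
  · rw [mem_degreeLT, hdeg, Nat.cast_lt]
    omega
  · have h1 := hWeight_add_card_zeros (extendedEval k a v (Lagrange.nodal T a))
    rw [card_zeros_extendedEval hv] at h1
    have h2 : T ⊆ ({i | (Lagrange.nodal T a).eval (a i) = 0} : Finset _) := fun i hi => by
      simp [Lagrange.eval_nodal_at_node hi]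
    have h3 := card_le_card h2
    omega

lemma sum_extendedEval_mul (hnk : n + 1 = 2 * k) (ha : Function.Injective a)
    (hv : ∀ i, v i * v i = -(∏ j ∈ univ.erase i, (a i - a j))⁻¹)
    {f g : F[X]} (hf : f ∈ degreeLT F k) (hg : g ∈ degreeLT F k) :
    ∑ i, extendedEval k a v f i * extendedEval k a v g i = 0 := by
  have hle {f : F[X]} (hf : f ∈ degreeLT F k) : f.natDegree ≤ k - 1 := by
    rw [mem_degreeLT] at hf
    refine natDegree_le_of_degree_le ?_
    rcases eq_or_ne f 0 with rfl | h0
    · simp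
    · rw [degree_eq_natDegree h0, Nat.cast_lt] at hf
      rw [degree_eq_natDegree h0, Nat.cast_le]
      omega
  have hdeg : (f * g).degree < #(univ : Finset (Fin n)) := by
    rw [card_univ, Fintype.card_fin]
    refine lt_of_le_of_lt (degree_le_of_natDegree_le
      (natDegree_mul_le.trans (add_le_add (hle hf) (hle hg)))) ?_
    rw [Nat.cast_lt]
    omega
  have h := Lagrange.coeff_eq_sum ha.injOn hdeg
  rw [card_univ, Fintype.card_fin, show n - 1 = (k - 1) + (k - 1) by omega,
    coeff_mul_add_eq_of_natDegree_le (hle hf) (hle hg)] at h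
  rw [Fin.sum_univ_succ]
  simp only [extendedEval, LinearMap.coe_mk, AddHom.coe_mk, Fin.cons_zero, Fin.cons_succ, h]
  rw [← sum_add_distrib]
  refine sum_eq_zero fun i _ => ?_
  rw [mul_mul_mul_comm, hv, eval_mul]
  ring

lemma finrank_euclideanDual (C : Submodule F (Fin n → F)) :
    Module.finrank F (euclideanDual C) = n - Module.finrank F C := by
  have h : (Matrix.toBilin' (1 : Matrix (Fin n) (Fin n) F)).Nondegenerate :=
    LinearMap.BilinForm.nondegenerate_toBilin'_of_det_ne_zero' 1 (by simp)
  have heq : euclideanDual C = (Matrix.toBilin' (1 : Matrix (Fin n) (Fin n) F)).orthogonal C := by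
    ext x
    rw [LinearMap.BilinForm.mem_orthogonal_iff]
    refine forall₂_congr fun c _ => ?_
    rw [Matrix.toBilin'_apply', Matrix.one_mulVec, dotProduct_comm]
    rfl
  rw [heq, LinearMap.BilinForm.finrank_orthogonal h, Module.finrank_fin_fun]

/-- An extended generalized Reed-Solomon code on the points `a i` can be made self-dual as soon as
each `-∏ j ≠ i, (a i - a j)` is a square. -/
theorem exists_isMDSSelfDual (hnk : n + 1 = 2 * k) (ha : Function.Injective a)
    (hsq : ∀ i, IsSquare (-∏ j ∈ univ.erase i, (a i - a j))) :
    ∃ C : Submodule F (Fin (n + 1) → F), IsMDSSelfDual C := by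
  choose w hw using hsq
  have hprod (i : Fin n) : ∏ j ∈ univ.erase i, (a i - a j) ≠ 0 :=
    prod_ne_zero_iff.2 fun j hj => sub_ne_zero.2 fun h => (mem_erase.1 hj).1 (ha h).symm
  set v : Fin n → F := fun i => (w i)⁻¹ with hvdef
  have hv (i : Fin n) : v i * v i = -(∏ j ∈ univ.erase i, (a i - a j))⁻¹ := by
    rw [hvdef, ← mul_inv, ← hw, neg_inv]
  have hv0 (i : Fin n) : v i ≠ 0 := fun h => by
    have := hv i
    rw [h, mul_zero, eq_comm, neg_eq_zero, inv_eq_zero] at this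
    exact hprod i this
  have hwt {f : F[X]} (hf : f ≠ 0) (hfk : f ∈ degreeLT F k) :=
    le_hWeight_extendedEval hnk ha hv0 hf hfk
  have hne {f : F[X]} (hf : f ≠ 0) (hfk : f ∈ degreeLT F k) : extendedEval k a v f ≠ 0 :=
    fun h => by simpa [h, hWeight] using hwt hf hfk
  have hk : (n + 1) / 2 + 1 = k + 1 := by omega
  refine ⟨(degreeLT F k).map (extendedEval k a v), ?_, ?_, ?_⟩
  · refine Submodule.eq_of_le_of_finrank_eq ?_ ?_
    · rintro _ ⟨f, hf, rfl⟩ _ ⟨g, hg, rfl⟩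
      exact sum_extendedEval_mul hnk ha hv hf hg
    · have hinj : Function.Injective ((extendedEval k a v).domRestrict (degreeLT F k)) := by
        rw [injective_iff_map_eq_zero]
        intro f hf
        by_contra h
        exact hne (fun h0 => h (Subtype.ext h0)) f.2 hf
      have hr : Module.finrank F ((degreeLT F k).map (extendedEval k a v)) = k := by
        rw [← LinearMap.range_domRestrict, LinearMap.finrank_range_of_inj hinj,
          (degreeLTEquiv F k).finrank_eq, Module.finrank_fin_fun]
      rw [finrank_euclideanDual, hr]
      omega
  · rintro _ ⟨f, hf, rfl⟩ h0
    rw [hk]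
    exact hwt (fun h => h0 (by rw [h, map_zero])) hf
  · obtain ⟨f, hfk, hf, hle⟩ := exists_hWeight_extendedEval_le (a := a) hnk hv0
    exact ⟨_, ⟨f, hfk, rfl⟩, hne hf hfk, by rw [hk]; exact hle.antisymm (hwt hf hfk)⟩

end ExtendedReedSolomon

/-- Version of `exists_isMDSSelfDual` for a finite set of evaluation points. -/
theorem exists_isMDSSelfDual_of_finset {F : Type*} [Field F] [DecidableEq F] {n : ℕ} (hn : Odd n)
    (A : Finset F) (hA : #A = n) (hsq : ∀ x ∈ A, IsSquare (-∏ y ∈ A.erase x, (x - y))) :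
    ∃ C : Submodule F (Fin (n + 1) → F), IsMDSSelfDual C := by
  obtain ⟨l, hl⟩ := hn
  let a : Fin n ↪ F := (A.equivFinOfCardEq hA).symm.toEmbedding.trans (Function.Embedding.subtype _)
  have hmap : univ.map a = A := by
    ext x
    simp only [mem_map, mem_univ, true_and]
    exact ⟨fun ⟨i, hi⟩ => hi ▸ ((A.equivFinOfCardEq hA).symm i).2,
      fun hx => ⟨A.equivFinOfCardEq hA ⟨x, hx⟩, by simp [a]⟩⟩
  refine exists_isMDSSelfDual (k := l + 1) (by omega) a.injective fun i => ?_
  have := hsq (a i) (hmap ▸ mem_map_of_mem a (mem_univ i))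
  rwa [← hmap, ← map_erase, prod_map] at this

section FiniteFieldPolynomials

open Polynomial

lemma prod_erase_sub_eq_eval_derivative {F : Type*} [Field F] [DecidableEq F] (A : Finset F)
    {x : F} (hx : x ∈ A) :
    ∏ y ∈ A.erase x, (x - y) = (derivative (Lagrange.nodal A id)).eval x := by
  have := Lagrange.eval_nodal_derivative_eval_node_eq (v := id) hx
  rw [id] at this
  rw [this, Lagrange.eval_nodal]
  rfl

lemma X_pow_sub_X_dvd {F : Type*} [Field F] [Fintype F] {d : ℕ}
    (hd : 0 < d) (h : d - 1 ∣ Fintype.card F - 1) :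
    (X ^ d - X : F[X]) ∣ X ^ Fintype.card F - X := by
  have key {n : ℕ} (hn : 0 < n) : (X ^ n - X : F[X]) = X * (X ^ (n - 1) - 1) := by
    rw [mul_sub, ← pow_succ', Nat.sub_add_cancel hn, mul_one]
  obtain ⟨c, hc⟩ := h
  rw [key hd, key Fintype.card_pos, hc, pow_mul]
  exact mul_dvd_mul_left _ (by simpa using sub_dvd_pow_sub_pow (X ^ (d - 1) : F[X]) 1 c)

variable {F : Type*} [Field F] [Fintype F] [DecidableEq F]

lemma nodal_roots_eq_of_dvd {f : F[X]} (hm : f.Monic)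
    (hf : f ∣ X ^ Fintype.card F - X) : Lagrange.nodal ({x | f.eval x = 0} : Finset F) id = f := by
  have h0 : (X ^ Fintype.card F - X : F[X]) ≠ 0 :=
    FiniteField.X_pow_card_sub_X_ne_zero F Fintype.one_lt_card
  have hle := roots.le_of_dvd h0 hf
  rw [FiniteField.roots_X_pow_card_sub_X] at hle
  have hs : f.Splits := Splits.of_dvd
    (splits_iff_card_roots.2 (by
      rw [FiniteField.roots_X_pow_card_sub_X,
        FiniteField.X_pow_card_sub_X_natDegree_eq F Fintype.one_lt_card]
      rfl)) h0 hf
  have hr : f.roots = ({x | f.eval x = 0} : Finset F).val := by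
    refine (Multiset.Nodup.ext (Multiset.nodup_of_le hle univ.nodup) (nodup _)).2 fun x => ?_
    simp [hm.ne_zero]
  conv_rhs => rw [hs.eq_prod_roots_of_monic hm, hr]
  rfl

lemma nodal_pow_eq_self {d : ℕ} (hd : 1 < d) (h : d - 1 ∣ Fintype.card F - 1) :
    Lagrange.nodal ({x | x ^ d = x} : Finset F) id = X ^ d - X := by
  have := nodal_roots_eq_of_dvd (monic_X_pow_sub (by simpa using hd))
    (X_pow_sub_X_dvd hd.le h)
  simpa [sub_eq_zero] using this

lemma card_pow_eq_self {d : ℕ} (hd : 1 < d) (h : d - 1 ∣ Fintype.card F - 1) :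
    #({x | x ^ d = x} : Finset F) = d := by
  rw [← Lagrange.natDegree_nodal (v := (id : F → F)), nodal_pow_eq_self hd h,
    FiniteField.X_pow_card_sub_X_natDegree_eq F hd]

variable {S : Finset F} {N M : ℕ}

lemma nodal_pow_mem (hNM : N * M + 1 = Fintype.card F) (hN : 0 < N) (hS : ∀ s ∈ S, s ^ M = 1) :
    Lagrange.nodal ({x | x ^ N ∈ S} : Finset F) id = (Lagrange.nodal S id).comp (X ^ N) := by
  have hm : ((Lagrange.nodal S id).comp (X ^ N)).Monic :=
    Lagrange.nodal_monic.comp (monic_X_pow N) (by rw [natDegree_X_pow]; exact hN.ne')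
  have hM : 0 < M := Nat.pos_of_ne_zero fun h => by
    have := Fintype.one_lt_card (α := F)
    rw [h] at hNM
    omega
  have h1 : Lagrange.nodal S id ∣ X ^ M - 1 :=
    (Multiset.prod_X_sub_C_dvd_iff_le_roots (monic_X_pow_sub_C (1 : F) hM.ne').ne_zero S.val).2
      ((Multiset.le_iff_subset S.nodup).2 fun s hs => by
        rw [mem_roots (monic_X_pow_sub_C (1 : F) hM.ne').ne_zero]
        simp [hS s hs])
  have h2 : (Lagrange.nodal S id).comp (X ^ N) ∣ X ^ Fintype.card F - X := by
    obtain ⟨g, hg⟩ := h1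
    refine ⟨X * g.comp (X ^ N), ?_⟩
    rw [mul_left_comm, ← mul_comp, ← hg, ← hNM]
    simp only [sub_comp, pow_comp, X_comp, one_comp]
    ring
  rw [← nodal_roots_eq_of_dvd hm h2]
  congr 1
  ext x
  simp [Lagrange.eval_nodal, prod_eq_zero_iff, sub_eq_zero]

lemma card_pow_mem (hNM : N * M + 1 = Fintype.card F) (hN : 0 < N) (hS : ∀ s ∈ S, s ^ M = 1) :
    #({x | x ^ N ∈ S} : Finset F) = #S * N := by
  rw [← Lagrange.natDegree_nodal (v := (id : F → F)), nodal_pow_mem hNM hN hS, natDegree_comp,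
    Lagrange.natDegree_nodal, natDegree_X_pow]

lemma prod_erase_pow_mem (hNM : N * M + 1 = Fintype.card F) (hN : 0 < N)
    (hS : ∀ s ∈ S, s ^ M = 1) {x : F} (hx : x ^ N ∈ S) :
    ∏ y ∈ ({x | x ^ N ∈ S} : Finset F).erase x, (x - y) =
      N * x ^ (N - 1) * ∏ s ∈ S.erase (x ^ N), (x ^ N - s) := by
  rw [prod_erase_sub_eq_eval_derivative _ (by simpa using hx),
    prod_erase_sub_eq_eval_derivative _ hx, nodal_pow_mem hNM hN hS, derivative_comp]
  simp [derivative_X_pow]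

lemma exists_finset_prod_erase_sub {K : Subfield F} {r t : ℕ} (hK : ∀ x, x ∈ K ↔ x ^ r = x)
    (ht : 0 < t) (hdvd : t ∣ r - 1) (htr : t < r - 1) (hr : r - 1 ∣ Fintype.card F - 1) :
    ∃ C : Finset F, #C = t + 1 ∧ (∀ c ∈ C, c ∈ K ∧ c ≠ 0) ∧
      ∀ c ∈ C, ∏ c' ∈ C.erase c, (c - c') = -1 ∨ ∏ c' ∈ C.erase c, (c - c') = t := by
  set C : Finset F := ({x | x ^ (t + 1) = x} : Finset F) with hCdef
  have htq : t + 1 - 1 ∣ Fintype.card F - 1 := hdvd.trans hr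
  have hC : #C = t + 1 := card_pow_eq_self (by omega) htq
  have hdich {x : F} (hx : x ∈ C) : x = 0 ∨ x ^ t = 1 := by
    simp only [hCdef, mem_filter, mem_univ, true_and] at hx
    refine or_iff_not_imp_left.2 fun h0 => mul_right_cancel₀ h0 ?_
    rw [← pow_succ, hx, one_mul]
  have hCK {x : F} (hx : x ∈ C) : x ∈ K := by
    rcases hdich hx with rfl | h1
    · exact K.zero_mem
    · obtain ⟨a, ha⟩ := hdvd
      rw [hK, show r = t * a + 1 by omega, pow_succ, pow_mul, h1, one_pow, one_mul]
  obtain ⟨c₀, hc₀, hc₀C⟩ : ∃ c₀ ∈ ({x | x ^ r = x} : Finset F), c₀ ∉ C :=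
    exists_mem_notMem_of_card_lt_card (by rw [hC, card_pow_eq_self (by omega) hr]; omega)
  have hc₀K : c₀ ∈ K := (hK _).2 (by simpa using hc₀)
  have hinj : Function.Injective fun x : F => x - c₀ := sub_left_injective
  refine ⟨C.image (· - c₀), by rw [card_image_of_injective _ hinj, hC], ?_, ?_⟩
  · simp only [forall_mem_image]
    exact fun x hx => ⟨K.sub_mem (hCK hx) hc₀K,
      sub_ne_zero.2 fun h => hc₀C (h ▸ hx)⟩
  · simp only [forall_mem_image]
    intro c hc
    rw [← image_erase hinj, prod_image hinj.injOn]
    simp only [sub_sub_sub_cancel_right]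
    rw [prod_erase_sub_eq_eval_derivative _ hc, hCdef, nodal_pow_eq_self (by omega) htq,
      derivative_sub, derivative_X_pow, derivative_X]
    rcases hdich hc with rfl | h1
    · exact .inl (by simp [ht.ne'])
    · exact .inr (by simp [h1])

end FiniteFieldPolynomials

lemma prod_symmetric {F : Type*} [Field F] [DecidableEq F] {B : Finset F}
    (hB : ∀ x ∈ B, -x ∈ B) (hne : ∀ x ∈ B, -x ≠ x) :
    ∃ (h : ℕ) (z : F), #B = 2 * h ∧ ∏ x ∈ B, x = (-1) ^ h * z ^ 2 := by
  let φ : B ≃ Fin #B := B.equivFin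
  let ψ : F → ℕ := fun x => if hx : x ∈ B then φ ⟨x, hx⟩ else 0
  have hψ {x y : F} (hx : x ∈ B) (hy : y ∈ B) (h : ψ x = ψ y) : x = y := by
    simp only [ψ, dif_pos hx, dif_pos hy] at h
    exact congrArg Subtype.val (φ.injective (Fin.ext h))
  have himg : B.filter (fun x => ¬ ψ x < ψ (-x)) = (B.filter fun x => ψ x < ψ (-x)).image (-·) := by
    ext x
    simp only [mem_filter, mem_image, not_lt]
    constructor
    · rintro ⟨hx, hle⟩
      exact ⟨-x, ⟨hB x hx, by
        rw [neg_neg]; exact hle.lt_of_ne fun h => hne x hx (hψ (hB x hx) hx h)⟩, neg_neg x⟩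
    · rintro ⟨y, ⟨hy, hlt⟩, rfl⟩
      exact ⟨hB y hy, by rw [neg_neg]; exact hlt.le⟩
  refine ⟨#(B.filter fun x => ψ x < ψ (-x)), ∏ x ∈ B with ψ x < ψ (-x), x, ?_, ?_⟩
  · rw [← card_filter_add_card_filter_not (s := B) fun x => ψ x < ψ (-x), himg,
      card_image_of_injective _ neg_injective, two_mul]
  · rw [← prod_filter_mul_prod_filter_not B fun x => ψ x < ψ (-x), himg,
      prod_image neg_injective.injOn, prod_neg]
    ring

section Cosets

variable {F : Type*} [Field F] {K : Subfield F} {V : Submodule K F} {u : F}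
  {B C : Finset F}

lemma Submodule.mul_mem_of_mem_subfield {c x : F} (hc : c ∈ K) (hx : x ∈ V) : c * x ∈ V :=
  V.smul_mem ⟨c, hc⟩ hx

lemma Submodule.eq_zero_of_mul_mem (hu : u ∉ V) {c : F} (hc : c ∈ K) (h : c * u ∈ V) : c = 0 := by
  by_contra h0
  have := V.mul_mem_of_mem_subfield (K.inv_mem hc) h
  rw [inv_mul_cancel_left₀ h0] at this
  exact hu this

lemma injOn_add_mul (hB : ∀ x, x ∈ B ↔ x ∈ V) (hu : u ∉ V) (hC : ∀ c ∈ C, c ∈ K) :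
    Set.InjOn (fun x : F × F => x.1 + x.2 * u) (B ×ˢ C : Finset (F × F)) := by
  rintro ⟨v, c⟩ h1 ⟨v', c'⟩ h2 h
  simp only [coe_product, Set.mem_prod, mem_coe] at h1 h2 h
  have hcc : c - c' = 0 := V.eq_zero_of_mul_mem hu (K.sub_mem (hC _ h1.2) (hC _ h2.2)) (by
    rw [show (c - c') * u = v' - v by linear_combination h]
    exact V.sub_mem ((hB _).1 h2.1) ((hB _).1 h1.1))
  obtain rfl := sub_eq_zero.1 hcc
  simpa using h

lemma prod_sub_add_mul (hB : ∀ x, x ∈ B ↔ x ∈ V) {v d : F} (hv : v ∈ V) (hd : d ∈ K)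
    (hd0 : d ≠ 0) : ∏ x ∈ B, (v - x + d * u) = d ^ #B * ∏ x ∈ B, (x + u) := by
  rw [← prod_const, ← prod_mul_distrib]
  refine prod_nbij' (fun x => d⁻¹ * (v - x)) (fun x => v - d * x) (fun x hx => ?_) (fun x hx => ?_)
    (fun x _ => ?_) (fun x _ => ?_) (fun x _ => ?_)
  · rw [hB] at hx ⊢
    exact V.mul_mem_of_mem_subfield (K.inv_mem hd) (V.sub_mem hv hx)
  · rw [hB] at hx ⊢
    exact V.sub_mem hv (V.mul_mem_of_mem_subfield hd hx)
  all_goals field_simp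
  all_goals ring

lemma prod_erase_image_add_mul [DecidableEq F] (hB : ∀ x, x ∈ B ↔ x ∈ V) (hu : u ∉ V) (hC : ∀ c ∈ C, c ∈ K)
    {v c : F} (hv : v ∈ B) (hc : c ∈ C) :
    ∏ y ∈ ((B ×ˢ C).image fun x : F × F => x.1 + x.2 * u).erase (v + c * u), (v + c * u - y) =
      (∏ x ∈ B.erase 0, x) * (∏ x ∈ B, (x + u)) ^ (#C - 1) *
        (∏ c' ∈ C.erase c, (c - c')) ^ #B := by
  have hinj := injOn_add_mul hB hu hC
  have hvc : (v, c) ∈ B ×ˢ C := mem_product.2 ⟨hv, hc⟩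
  have himg : ((B ×ˢ C).image fun x : F × F => x.1 + x.2 * u).erase (v + c * u) =
      ((B ×ˢ C).erase (v, c)).image fun x : F × F => x.1 + x.2 * u := by
    ext y
    simp only [mem_erase, mem_image]
    constructor
    · rintro ⟨hne, x, hx, rfl⟩
      exact ⟨x, ⟨fun h => hne (by rw [h]), hx⟩, rfl⟩
    · rintro ⟨x, ⟨hne, hx⟩, rfl⟩
      exact ⟨fun h => hne (hinj hx hvc h), x, hx, rfl⟩
  have hsplit : (B ×ˢ C).erase (v, c) = (B.erase v ×ˢ {c}) ∪ (B ×ˢ C.erase c) := by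
    ext ⟨x, y⟩
    simp only [mem_erase, mem_product, mem_union, mem_singleton, Prod.mk.injEq, ne_eq]
    by_cases hy : y = c
    · subst hy; simp [hc]
    · simp [hy]
  have hdisj : Disjoint (B.erase v ×ˢ {c}) (B ×ˢ C.erase c) :=
    disjoint_product.2 (.inr (by simp))
  rw [himg, prod_image (hinj.mono (by simp)), hsplit, prod_union hdisj, prod_product,
    prod_product_right]
  have h1 : ∏ x ∈ B.erase v, ∏ y ∈ {c}, (v + c * u - (x + y * u)) = ∏ x ∈ B.erase 0, x := by
    refine prod_nbij' (fun x => v - x) (fun x => v - x) (fun x hx => ?_) (fun x hx => ?_)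
      (fun x _ => ?_) (fun x _ => ?_) (fun x _ => ?_)
    · rw [mem_erase, hB] at hx ⊢
      exact ⟨sub_ne_zero.2 hx.1.symm, V.sub_mem ((hB _).1 hv) hx.2⟩
    · rw [mem_erase, hB] at hx ⊢
      exact ⟨by simpa using hx.1, V.sub_mem ((hB _).1 hv) hx.2⟩
    · ring
    · ring
    · rw [prod_singleton]; ring
  have h2 : ∏ y ∈ C.erase c, ∏ x ∈ B, (v + c * u - (x + y * u)) =
      ∏ y ∈ C.erase c, ((c - y) ^ #B * ∏ x ∈ B, (x + u)) := by
    refine prod_congr rfl fun y hy => ?_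
    rw [mem_erase] at hy
    rw [← prod_sub_add_mul hB ((hB _).1 hv) (K.sub_mem (hC _ hc) (hC _ hy.2))
      (sub_ne_zero.2 hy.1.symm)]
    exact prod_congr rfl fun x _ => by ring
  rw [h1, h2, prod_mul_distrib, prod_const, prod_pow, card_erase_of_mem hc]
  ring

end Cosets

lemma exists_submodule_finrank_eq_and_notMem {K M : Type*} [Field K] [AddCommGroup M] [Module K M]
    {W : Submodule K M} {e : ℕ} (he : e < Module.finrank K W) :
    ∃ V ≤ W, Module.finrank K V = e ∧ ∃ u ∈ W, u ∉ V := by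
  obtain ⟨f, hf⟩ := exists_linearIndependent_of_le_finrank (Nat.succ_le_of_lt he)
  have hf' := linearIndependent_finSucc'.1 (hf.map' W.subtype W.ker_subtype)
  refine ⟨_, ?_, (finrank_span_eq_card hf'.1).trans (Fintype.card_fin e), _, ?_, hf'.2⟩
  · rw [Submodule.span_le]
    rintro _ ⟨i, rfl⟩
    exact (f _).2
  · exact (f _).2

section Subfields

variable {F : Type*} [Field F] {p k r : ℕ}

lemma exists_subfield_mem_iff_pow_eq_self [Fact p.Prime] [CharP F p] (hr : r = p ^ k) :
    ∃ K : Subfield F, ∀ x, x ∈ K ↔ x ^ r = x :=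
  ⟨(iterateFrobenius F p k).eqLocusField (RingHom.id F), fun x => by
    rw [RingHom.mem_eqLocusField, iterateFrobenius_def, hr, RingHom.id_apply]⟩

lemma exists_submodule_mem_iff_pow_eq_self [Fact p.Prime] [CharP F p] (hr : r = p ^ k)
    {K : Subfield F} (hK : ∀ x, x ∈ K ↔ x ^ r = x) (s : ℕ) :
    ∃ W : Submodule K F, ∀ x, x ∈ W ↔ x ^ r ^ s = x := by
  obtain ⟨L, hL⟩ := exists_subfield_mem_iff_pow_eq_self (F := F) (p := p) (k := k * s)
    (r := r ^ s) (by rw [hr, pow_mul])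
  have hKL (c : F) (hc : c ∈ K) : c ∈ L := by
    rw [hL]
    clear hL
    induction s with
    | zero => simp
    | succ s ih => rw [pow_succ, pow_mul, ih, (hK c).1 hc]
  exact ⟨{ carrier := L
           add_mem' := L.add_mem
           zero_mem' := L.zero_mem
           smul_mem' := fun c _ hx => L.mul_mem (hKL c c.2) hx }, hL⟩

lemma natCard_subtype_eq_of_mem_iff [Fintype F] [DecidableEq F] {d : ℕ} (hd : 1 < d)
    (h : d - 1 ∣ Fintype.card F - 1) {P : F → Prop} (hP : ∀ x, P x ↔ x ^ d = x) :
    Nat.card {x // P x} = d := by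
  rw [Nat.subtype_card ({x | x ^ d = x} : Finset F) (by simp [hP]), card_pow_eq_self hd h]

end Subfields

/-- If `S` is the union of the cosets `V + c * u` for `c ∈ C`, then the set of `N`-th roots of the
elements of `S` satisfies the square condition of `exists_isMDSSelfDual_of_finset` as soon as `C`
does. -/
lemma isSquare_neg_prod_erase_pow_mem {F : Type*} [Field F] [Fintype F] [DecidableEq F]
    {K : Subfield F} {V : Submodule K F} {u : F} {B C S : Finset F} {N M h t : ℕ}
    (hNM : N * M + 1 = Fintype.card F) (hN : Odd N) (hN1 : (N : F) = 1)
    (hS : S = (B ×ˢ C).image fun x : F × F => x.1 + x.2 * u)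
    (hSM : ∀ s ∈ S, s ^ M = 1)
    (hB : ∀ x, x ∈ B ↔ x ∈ V) (hu : u ∉ V) (hC : ∀ c ∈ C, c ∈ K)
    (hcard : #C = t + 1) (ht : Even t) (hBh : #B = 2 * h + 1)
    (h2 : ∀ x : F, x ≠ 0 → -x ≠ x) (hh : IsSquare ((-1 : F) ^ h))
    (hsq : ∀ c ∈ C, IsSquare (-∏ c' ∈ C.erase c, (c - c'))) {x : F}
    (hx : x ∈ ({x | x ^ N ∈ S} : Finset F)) :
    IsSquare (-∏ y ∈ ({x | x ^ N ∈ S} : Finset F).erase x, (x - y)) := by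
  simp only [mem_filter, mem_univ, true_and] at hx
  rw [prod_erase_pow_mem hNM hN.pos hSM hx, hN1, one_mul]
  rw [hS] at hx
  obtain ⟨⟨v, c⟩, hvc, hxvc⟩ := mem_image.1 hx
  rw [mem_product] at hvc
  rw [hS, ← hxvc, prod_erase_image_add_mul hB hu hC hvc.1 hvc.2, hcard, Nat.add_sub_cancel]
  obtain ⟨h', z, hh', hz⟩ := prod_symmetric (B := B.erase 0)
    (fun x hx => by
      rw [mem_erase, hB] at hx ⊢
      exact ⟨neg_ne_zero.2 hx.1, V.neg_mem hx.2⟩)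
    (fun x hx => h2 x (mem_erase.1 hx).1)
  rw [card_erase_of_mem ((hB 0).2 V.zero_mem)] at hh'
  obtain rfl : h' = h := by omega
  obtain ⟨N', hN'⟩ := hN
  obtain ⟨t', ht'⟩ := ht
  rw [hz, hBh, hN', Nat.add_sub_cancel, ht']
  refine (congrArg IsSquare ?_).mpr <| (hh.mul (hsq c hvc.2)).mul (IsSquare.sq
    (x ^ N' * (∏ x ∈ B, (x + u)) ^ t' * z * (∏ c' ∈ C.erase c, (c - c')) ^ h'))
  ring

lemma even_of_sq_eq_two_mul_add_one {w h : ℕ} (hw : w ^ 2 = 2 * h + 1) : Even h := by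
  have hodd : Odd w := Nat.odd_pow_iff two_ne_zero |>.1 (hw ▸ odd_two_mul_add_one h)
  obtain ⟨j, rfl⟩ := hodd
  exact ⟨j * (j + 1), by nlinarith⟩

lemma isSquare_of_quadChar_eq_one {F : Type*} [Field F] {x : F} (h : quadChar F x = 1) :
    IsSquare x := by
  unfold quadChar at h
  split_ifs at h <;> simp_all

theorem stmt_11 (r s m e t p k : ℕ) (hp : p.Prime) (hpodd : Odd p) (hr : r = p ^ k)
    (hk : 0 < k) (hs : 0 < s) (hm : Odd m) (hm0 : 0 < m)
    (ht : Even t) (hdvd : t ∣ r - 1) (ht1 : 1 ≤ t) (ht2 : t < r - 1) (he : e ≤ s - 1)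
    (F : Type*) [Field F] [Fintype F] (hF : Fintype.card F = r ^ (s * m))
    (hcase : (quadChar F ((t : ℕ) : F) = 1 ∧ quadChar F (-1 : F) = 1) ∨
      (quadChar F (-((t : ℕ) : F)) = 1 ∧ Even e)) :
    ∃ C : Submodule F
        (Fin ((t + 1) * r ^ e * (∑ i ∈ Finset.range m, r ^ (s * i)) + 1) → F),
      IsMDSSelfDual C := by
  classical
  have := Fact.mk hp
  have : CharP F p := charP_of_card_eq_prime_pow (f := k * (s * m)) (by rw [hF, hr, ← pow_mul])
  have hrodd : Odd r := hr ▸ hpodd.pow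
  have hr1 : 1 < r := by omega
  have hrq : r - 1 ∣ Fintype.card F - 1 := by
    simpa [hF] using Nat.sub_dvd_pow_sub_pow r 1 (s * m)
  have hQ1 : 1 < r ^ s := Nat.one_lt_pow hs.ne' hr1
  have hNM : (∑ i ∈ range m, r ^ (s * i)) * (r ^ s - 1) + 1 = Fintype.card F := by
    have := geom_sum_mul_add (r ^ s - 1) m
    rw [Nat.sub_add_cancel hQ1.le] at this
    simpa only [hF, pow_mul] using this
  have hN : Odd (∑ i ∈ range m, r ^ (s * i)) := by
    rw [odd_sum_iff_odd_card_odd, filter_true_of_mem fun i _ => hrodd.pow, card_range]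
    exact hm
  set N := ∑ i ∈ range m, r ^ (s * i) with hNdef
  have hN1 : (N : F) = 1 := by
    have hr0 : (r : F) = 0 := by rw [hr, Nat.cast_pow, CharP.cast_eq_zero, zero_pow hk.ne']
    have := congrArg (Nat.cast (R := F)) hNM
    rw [FiniteField.cast_card_eq_zero, Nat.cast_add, Nat.cast_mul, Nat.cast_sub hQ1.le,
      Nat.cast_pow, hr0, zero_pow hs.ne', Nat.cast_one] at this
    linear_combination -this
  have hMq : r ^ s - 1 ∣ Fintype.card F - 1 := ⟨N, by rw [← hNM, Nat.add_sub_cancel, mul_comm]⟩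
  obtain ⟨K, hK⟩ := exists_subfield_mem_iff_pow_eq_self (F := F) hr
  obtain ⟨W, hW⟩ := exists_submodule_mem_iff_pow_eq_self hr hK s
  have hcardK : Nat.card K = r := natCard_subtype_eq_of_mem_iff hr1 hrq hK
  have hcardW : Nat.card W = r ^ s := natCard_subtype_eq_of_mem_iff hQ1 hMq hW
  have hrank : Module.finrank K W = s := by
    rw [Module.natCard_eq_pow_finrank (K := K), hcardK] at hcardW
    exact Nat.pow_right_injective hr1 hcardW
  obtain ⟨V, hVW, hV, u, huW, hu⟩ :=
    exists_submodule_finrank_eq_and_notMem (W := W) (e := e) (by omega)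
  obtain ⟨C, hCcard, hCK, hCprod⟩ := exists_finset_prod_erase_sub hK (by omega) hdvd ht2 hrq
  set B : Finset F := {x | x ∈ V} with hBdef
  have hB (x : F) : x ∈ B ↔ x ∈ V := by simp [hBdef]
  have hBcard : #B = r ^ e := by
    rw [← Nat.subtype_card B hB, ← hcardK, ← hV]
    exact Module.natCard_eq_pow_finrank
  set S := (B ×ˢ C).image fun x : F × F => x.1 + x.2 * u with hS
  have hScard : #S = r ^ e * (t + 1) := by
    rw [hS, card_image_of_injOn (injOn_add_mul hB hu fun c hc => (hCK c hc).1), card_product,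
      hBcard, hCcard]
  have hSM (y : F) (hy : y ∈ S) : y ^ (r ^ s - 1) = 1 := by
    obtain ⟨⟨v, c⟩, hvc, rfl⟩ := mem_image.1 hy
    rw [mem_product, hB] at hvc
    have hmem : v + c * u ∈ W :=
      W.add_mem (hVW hvc.1) (W.mul_mem_of_mem_subfield (hCK c hvc.2).1 huW)
    have hne : v + c * u ≠ 0 := fun h => (hCK c hvc.2).2 <|
      V.eq_zero_of_mul_mem hu (hCK c hvc.2).1 (by
        rw [show c * u = -v by linear_combination h]
        exact V.neg_mem hvc.1)
    refine mul_right_cancel₀ hne ?_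
    rw [← pow_succ, Nat.sub_add_cancel hQ1.le, (hW _).1 hmem, one_mul]
  obtain ⟨h, hh⟩ : Odd (r ^ e) := hrodd.pow
  have hneg1 : IsSquare ((-1 : F) ^ h) := by
    rcases hcase with ⟨-, h1⟩ | ⟨-, e', he'⟩
    · exact (isSquare_of_quadChar_eq_one h1).pow h
    · rw [(even_of_sq_eq_two_mul_add_one (w := r ^ e') (by rw [← hh, he']; ring)).neg_one_pow]
      exact IsSquare.one
  have hnegt : IsSquare (-(t : F)) := by
    rcases hcase with ⟨h1, h2⟩ | ⟨h1, -⟩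
    · simpa using (isSquare_of_quadChar_eq_one h2).mul (isSquare_of_quadChar_eq_one h1)
    · exact isSquare_of_quadChar_eq_one h1
  have h2 : (2 : F) ≠ 0 := Ring.two_ne_zero (by
    rw [ringChar.eq F p]
    rintro rfl
    exact absurd hpodd (by decide))
  refine exists_isMDSSelfDual_of_finset ((ht.add_one.mul hrodd.pow).mul hN)
    ({x | x ^ N ∈ S} : Finset F) (by rw [card_pow_mem hNM hN.pos hSM, hScard]; ring)
    fun x hx => isSquare_neg_prod_erase_pow_mem hNM hN hN1 hS hSM hB hu
      (fun c hc => (hCK c hc).1) hCcard ht (hBcard.trans hh)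
      (fun x hx hxx => hx ((mul_eq_zero.1 (by linear_combination -hxx : 2 * x = 0)).resolve_left h2))
      hneg1 (fun c hc => ?_) hx
  rcases hCprod c hc with h1 | h1 <;> rw [h1]
  · rw [neg_neg]
    exact IsSquare.one
  · exact hnegt
end

section
/- Let q = r^2 where r is an odd prime power, and write q − 1 = e·f for positive integers e, f. Let s be a positive integer with s ∣ f and s ∣ r−1, and set D = s(r+1)/gcd(s(r+1), f). Let t be an integer with 1 ≤ t ≤ D such that t·f is even. If e is even and (r − 1 + f·t)/s is an even integer, then there exists an MDS self-dual code over F_q of length t·f. -/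
open Finset

open Polynomial in
/-- The generalized Reed-Solomon code with evaluation points `x`, column multipliers `v` and
dimension bound `m`. -/
noncomputable def grsCode {F : Type*} [Field F] {n : ℕ} (x v : Fin n → F) (m : ℕ) :
    Submodule F (Fin n → F) :=
  (degreeLT F m).map (LinearMap.pi fun i => v i • leval (x i))

section GRS

open Polynomial

variable {F : Type*} [Field F] {n : ℕ}

theorem mem_grsCode {x v : Fin n → F} {m : ℕ} {c : Fin n → F} :
    c ∈ grsCode x v m ↔ ∃ g : F[X], g.degree < m ∧ ∀ i, c i = v i * g.eval (x i) := by
  simp only [grsCode, Submodule.mem_map, mem_degreeLT]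
  refine exists_congr fun g => and_congr_right fun _ => ⟨?_, fun h => ?_⟩
  · rintro rfl i
    simp [leval_apply]
  · ext i
    simp [leval_apply, h i]

theorem hWeight_add_card_roots {x v : Fin n → F} (hv : ∀ i, v i ≠ 0) (g : F[X])
    [DecidableEq F] {c : Fin n → F} (hc : ∀ i, c i = v i * g.eval (x i)) :
    hWeight c + #{i | g.eval (x i) = 0} = n := by
  have h : hWeight c = #{i | ¬ g.eval (x i) = 0} := by
    rw [hWeight, Nat.card_eq_fintype_card, Fintype.card_subtype]
    congr 1
    ext i
    simp [hc, hv]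
  have := Finset.card_filter_add_card_filter_not (s := (univ : Finset (Fin n)))
    (fun i => g.eval (x i) = 0)
  rw [Finset.card_univ, Fintype.card_fin] at this
  omega

theorem card_index_roots_le {x : Fin n → F} (hx : Function.Injective x) {g : F[X]} (hg : g ≠ 0)
    [DecidableEq F] : #{i | g.eval (x i) = 0} ≤ g.natDegree := by
  rw [← Finset.card_image_of_injective _ hx]
  refine card_le_degree_of_subset_roots fun a ha => ?_
  obtain ⟨i, hi, rfl⟩ := Finset.mem_image.1 (Finset.mem_def.2 ha)
  exact (mem_roots hg).2 (by simpa using hi)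

theorem lt_hWeight_of_mem_grsCode {x v : Fin n → F} (hx : Function.Injective x)
    (hv : ∀ i, v i ≠ 0) {m : ℕ} {c : Fin n → F} (hc : c ∈ grsCode x v m)
    (hc0 : c ≠ 0) : n < hWeight c + m := by
  classical
  obtain ⟨g, hgm, hg⟩ := mem_grsCode.1 hc
  have hg0 : g ≠ 0 := by
    rintro rfl
    exact hc0 (funext fun i => by simp [hg])
  have h1 := hWeight_add_card_roots hv g hg
  have h2 := card_index_roots_le hx hg0
  have h3 := (natDegree_lt_iff_degree_lt hg0).2 hgm
  omega

theorem exists_mem_grsCode_hWeight_eq {x v : Fin n → F} (hx : Function.Injective x)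
    (hv : ∀ i, v i ≠ 0) {m : ℕ} (hm : 0 < m) (hmn : m ≤ n) :
    ∃ c ∈ grsCode x v m, c ≠ 0 ∧ hWeight c = n + 1 - m := by
  classical
  obtain ⟨S, -, hS⟩ := Finset.exists_subset_card_eq
    (s := (univ : Finset (Fin n))) (n := m - 1) (by simp; omega)
  set g : F[X] := Lagrange.nodal S x
  have hroots : #{i | g.eval (x i) = 0} = m - 1 := by
    rw [← hS]
    congr 1
    ext i
    simp only [g, mem_filter, mem_univ, true_and, Lagrange.eval_nodal, Finset.prod_eq_zero_iff,
      sub_eq_zero]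
    exact ⟨fun ⟨j, hj, hij⟩ => hx hij ▸ hj, fun hi => ⟨i, hi, rfl⟩⟩
  have hw := hWeight_add_card_roots hv g (c := fun i => v i * g.eval (x i)) fun i => rfl
  refine ⟨fun i => v i * g.eval (x i), mem_grsCode.2 ⟨g, ?_, fun i => rfl⟩, ?_, by omega⟩
  · rw [Lagrange.degree_nodal, hS]
    exact_mod_cast Nat.sub_lt hm one_pos
  · intro h0
    have : hWeight (0 : Fin n → F) = 0 := by simp [hWeight]
    rw [h0] at hw
    omega

theorem grsCode_eq_euclideanDual {x v : Fin n → F} (hx : Function.Injective x)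
    (hv : ∀ i, v i ≠ 0) {m : ℕ} (hmn : 2 * m = n) {c : F}
    (hc : ∀ i, v i * v i = c / ∏ j ∈ univ.erase i, (x i - x j)) :
    grsCode x v m = euclideanDual (grsCode x v m) := by
  have hsum : ∀ P : F[X], P.degree < n →
      ∑ i, v i * v i * P.eval (x i) = c * P.coeff (n - 1) := fun P hP => by
    have := Lagrange.coeff_eq_sum (s := univ) hx.injOn (P := P) (by simpa using hP)
    rw [Finset.card_univ, Fintype.card_fin] at this
    rw [this, Finset.mul_sum]
    exact Finset.sum_congr rfl fun i _ => by rw [hc]; ring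
  ext y
  change _ ↔ ∀ b ∈ grsCode x v m, ∑ i, y i * b i = 0
  constructor
  · intro hy b hb
    obtain ⟨g, hgm, hg⟩ := mem_grsCode.1 hy
    obtain ⟨h, hhm, hh⟩ := mem_grsCode.1 hb
    have hdeg : (g * h).degree < ((n - 1 : ℕ) : WithBot ℕ) := by
      by_cases hg0 : g = 0
      · simp [hg0]
      by_cases hh0 : h = 0
      · simp [hh0]
      rw [← natDegree_lt_iff_degree_lt (mul_ne_zero hg0 hh0), natDegree_mul hg0 hh0]
      have h1 := (natDegree_lt_iff_degree_lt hg0).2 hgm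
      have h2 := (natDegree_lt_iff_degree_lt hh0).2 hhm
      omega
    have := hsum (g * h) (hdeg.trans_le (by exact_mod_cast Nat.sub_le n 1))
    rw [coeff_eq_zero_of_degree_lt hdeg, mul_zero] at this
    rw [← this]
    exact Finset.sum_congr rfl fun i _ => by rw [hg, hh, eval_mul]; ring
  · intro hy
    set g : F[X] := Lagrange.interpolate univ x fun i => y i / v i with hgdef
    have hgn : g.degree < n := by
      have := Lagrange.degree_interpolate_lt (s := univ) (fun i => y i / v i) hx.injOn
      rwa [Finset.card_univ, Fintype.card_fin] at this
    have hg : ∀ i, y i = v i * g.eval (x i) := fun i => by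
      rw [hgdef, Lagrange.eval_interpolate_at_node _ hx.injOn (mem_univ i)]
      field_simp [hv i]
    refine mem_grsCode.2 ⟨g, ?_, hg⟩
    by_contra hlt
    have hg0 : g ≠ 0 := by
      rintro h
      simp [h] at hlt
    have hd : m ≤ g.natDegree := by
      by_contra h
      exact hlt ((natDegree_lt_iff_degree_lt hg0).1 (not_le.1 h))
    have hd' := (natDegree_lt_iff_degree_lt hg0).2 hgn
    have hb := hy (fun i => v i * (X ^ (n - 1 - g.natDegree) : F[X]).eval (x i))
      (mem_grsCode.2 ⟨_, by rw [degree_X_pow]; exact_mod_cast (by omega), fun i => rfl⟩)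
    have hdeg : g.natDegree + (n - 1 - g.natDegree) = n - 1 := by omega
    have hs := hsum (g * X ^ (n - 1 - g.natDegree)) (by
      rw [degree_mul, degree_X_pow, degree_eq_natDegree hg0]
      exact_mod_cast (by omega))
    have hzero : c * g.leadingCoeff = 0 := by
      rw [leadingCoeff, ← coeff_mul_X_pow g (n - 1 - g.natDegree), hdeg, ← hs, ← hb]
      exact Finset.sum_congr rfl fun i _ => by rw [hg i, eval_mul]; ring
    have hc0 : c ≠ 0 := by
      rintro rfl
      exact hv ⟨0, by omega⟩ (by simpa using hc ⟨0, by omega⟩)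
    exact (mul_ne_zero hc0 (leadingCoeff_ne_zero.2 hg0)) hzero

theorem exists_isMDSSelfDual_of_isSquare (hn : Even n) (hpos : 0 < n) {x : Fin n → F}
    (hx : Function.Injective x) {c : F} (hc : c ≠ 0)
    (hsq : ∀ i, IsSquare (c * (derivative (∏ j, (X - C (x j)))).eval (x i))) :
    ∃ D : Submodule F (Fin n → F), IsMDSSelfDual D := by
  choose w hw using hsq
  have hu : ∀ i, (derivative (∏ j, (X - C (x j)))).eval (x i) = ∏ j ∈ univ.erase i, (x i - x j) :=
    fun i => by
      rw [← Lagrange.nodal_eq, Lagrange.eval_nodal_derivative_eval_node_eq (mem_univ i),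
        Lagrange.eval_nodal]
  have hu0 : ∀ i, ∏ j ∈ univ.erase i, (x i - x j) ≠ 0 := fun i =>
    Finset.prod_ne_zero_iff.2 fun j hj => sub_ne_zero.2 fun h => (Finset.mem_erase.1 hj).1 (hx h).symm
  have hw0 : ∀ i, w i ≠ 0 := fun i h => by
    have := hw i
    rw [h, mul_zero, hu] at this
    exact mul_ne_zero hc (hu0 i) this
  obtain ⟨m, rfl⟩ := hn
  have hv : ∀ i, (w i)⁻¹ ≠ 0 := fun i => inv_ne_zero (hw0 i)
  refine ⟨grsCode x (fun i => (w i)⁻¹) m, ?_, fun b hb hb0 => ?_, ?_⟩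
  · refine grsCode_eq_euclideanDual hx hv (two_mul m) (c := c⁻¹) fun i => ?_
    rw [← mul_inv, ← hw, hu, mul_inv, div_eq_mul_inv]
  · have := lt_hWeight_of_mem_grsCode hx hv hb hb0
    omega
  · obtain ⟨b, hb, hb0, h⟩ := exists_mem_grsCode_hWeight_eq hx hv (m := m) (by omega) (by omega)
    exact ⟨b, hb, hb0, by omega⟩

end GRS

section CosetUnion

open Polynomial

variable {F : Type*} [Field F]

/-- The elements of the cosets `ζ ^ i * ⟨α⟩`, `i < t`, of the group generated by an element `α` of
order `f`. -/
def cosetPoint (ζ α : F) (t f : ℕ) (a : Fin t × Fin f) : F :=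
  α ^ (a.2 : ℕ) * ζ ^ (a.1 : ℕ)

theorem cosetPoint_pow {ζ α : F} {t f : ℕ} (hα : IsPrimitiveRoot α f) (a : Fin t × Fin f) :
    cosetPoint ζ α t f a ^ f = (ζ ^ f) ^ (a.1 : ℕ) := by
  rw [cosetPoint, mul_pow, pow_right_comm, hα.pow_eq_one, one_pow, one_mul, pow_right_comm]

theorem cosetPoint_injective {ζ α : F} {t f : ℕ} (hα : IsPrimitiveRoot α f) (hζ : ζ ≠ 0)
    (ht : t ≤ orderOf (ζ ^ f)) : Function.Injective (cosetPoint ζ α t f) := by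
  rintro ⟨i, m⟩ ⟨j, l⟩ h
  have hpow := congrArg (· ^ f) h
  simp only [cosetPoint_pow hα] at hpow
  have hij : i = j := Fin.ext
    (pow_injOn_Iio_orderOf (i.2.trans_le ht) (j.2.trans_le ht) hpow)
  subst hij
  have hml := mul_right_cancel₀ (pow_ne_zero _ hζ) h
  rw [Fin.ext (hα.pow_inj m.2 l.2 hml)]

theorem prod_X_sub_C_cosetPoint {ζ α : F} {t f : ℕ} (hα : IsPrimitiveRoot α f) (hf : 0 < f) :
    ∏ a, (X - C (cosetPoint ζ α t f a)) = ∏ i : Fin t, (X ^ f - C ((ζ ^ f) ^ (i : ℕ))) := by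
  rw [Fintype.prod_prod_type]
  refine Finset.prod_congr rfl fun i _ => ?_
  rw [X_pow_sub_C_eq_prod hα hf (pow_right_comm ζ i f),
    ← Fin.prod_univ_eq_prod_range (fun m => X - C (α ^ m * ζ ^ (i : ℕ)))]
  rfl

theorem eval_derivative_prod_X_pow_sub_C {ι : Type*} [Fintype ι] [DecidableEq ι] (γ : ι → F)
    {f : ℕ} {i : ι} {a : F} (ha : a ^ f = γ i) :
    (derivative (∏ j, (X ^ f - C (γ j)))).eval a =
      f * a ^ (f - 1) * ∏ j ∈ univ.erase i, (γ i - γ j) := by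
  rw [← Finset.mul_prod_erase _ _ (mem_univ i)]
  simp [ha, eval_prod, derivative_X_pow]

/-- If the elements `γ j` have relative norm `1` over the subfield with `p ^ k` elements, the
`(p ^ k - 1)`-th powers of their differences are explicit. -/
theorem prod_sub_pow_of_pow_add_one_eq_one {p k : ℕ} [Fact p.Prime] [CharP F p] {ι : Type*}
    [Fintype ι] [DecidableEq ι] {γ : ι → F} (hγ : Function.Injective γ)
    (hnorm : ∀ i, γ i ^ (p ^ k + 1) = 1) (i : ι) :
    (∏ j ∈ univ.erase i, (γ i - γ j)) ^ (p ^ k - 1) * (γ i ^ Fintype.card ι * ∏ j, γ j) =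
      (-1) ^ (Fintype.card ι - 1) * γ i ^ 2 := by
  have hfac : ∀ j ∈ univ.erase i, (γ i - γ j) ^ (p ^ k - 1) * (γ i * γ j) = -1 := fun j hj => by
    have hsub : γ i - γ j ≠ 0 := sub_ne_zero.2 fun h => (Finset.mem_erase.1 hj).1 (hγ h).symm
    refine mul_left_cancel₀ hsub ?_
    rw [← mul_assoc, mul_pow_sub_one (pow_ne_zero _ (Fact.out : p.Prime).ne_zero),
      sub_pow_char_pow]
    have hi := hnorm i
    have hj := hnorm j
    rw [pow_succ] at hi hj
    linear_combination γ j * hi - γ i * hj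
  have hprod := Finset.prod_congr rfl hfac
  rw [Finset.prod_mul_distrib, Finset.prod_pow, Finset.prod_const,
    Finset.card_erase_of_mem (mem_univ i), Finset.card_univ] at hprod
  have hall := Finset.mul_prod_erase univ (fun j => γ i * γ j) (mem_univ i)
  rw [Finset.prod_mul_distrib (s := univ), Finset.prod_const, Finset.card_univ] at hall
  rw [← hall, ← hprod]
  ring

/-- The quadratic character of the derivative at the coset points does not depend on the point. -/
theorem exists_eval_derivative_cosetPoint_pow_eq {p k s t f h : ℕ} [Fact p.Prime] [CharP F p]
    {ζ α : F} (hα : IsPrimitiveRoot α f) (hf : 0 < f) (ht : t ≤ orderOf (ζ ^ f))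
    (hζ : ζ ^ (s * (p ^ k + 1)) = 1) (hh : p ^ k + 1 = 2 * h) (hsf : s ∣ f)
    (hcond : 2 * s ∣ p ^ k - 1 + f * t) (hαh : α ^ ((p ^ k - 1) * h) = 1) :
    ∃ K : F, ∀ a, (derivative (∏ b, (X - C (cosetPoint ζ α t f b)))).eval
      (cosetPoint ζ α t f a) ^ ((p ^ k - 1) * h) = K := by
  have hζ0 : ζ ≠ 0 := by
    rintro rfl
    rcases Nat.eq_zero_or_pos s with rfl | hs
    · obtain rfl := Nat.eq_zero_of_zero_dvd hsf
      exact hf.ne rfl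
    · rw [zero_pow (by positivity)] at hζ
      exact zero_ne_one hζ
  obtain ⟨u, hu⟩ := hcond
  obtain ⟨w, hw⟩ : 2 ∣ p ^ k - 1 := by omega
  obtain ⟨g, rfl⟩ := hsf
  set γ : Fin t → F := fun i => (ζ ^ (s * g)) ^ (i : ℕ)
  have hγinj : Function.Injective γ := fun i j hij =>
    Fin.ext (pow_injOn_Iio_orderOf (i.2.trans_le ht) (j.2.trans_le ht) hij)
  have hγnorm : ∀ i, γ i ^ (p ^ k + 1) = 1 := fun i => by
    simp only [γ, ← pow_mul]
    rw [show s * g * i * (p ^ k + 1) = s * (p ^ k + 1) * (g * i) by ring, pow_mul, hζ, one_pow]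
  have hγ0 : ∀ i, γ i ≠ 0 := fun i => pow_ne_zero _ (pow_ne_zero _ hζ0)
  have hexp : ζ ^ ((s * g - 1) * ((p ^ k - 1) * h)) = ζ ^ (s * g * (t * h)) := by
    refine mul_right_cancel₀ (pow_ne_zero ((p ^ k - 1) * h) hζ0) ?_
    have h1 : (s * g - 1) * ((p ^ k - 1) * h) + (p ^ k - 1) * h = s * (p ^ k + 1) * (g * w) := by
      rw [← Nat.succ_mul, Nat.succ_eq_add_one, Nat.sub_add_cancel hf, hw, hh]
      ring
    have h2 : s * g * (t * h) + (p ^ k - 1) * h = s * (p ^ k + 1) * u := by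
      rw [hh]
      linear_combination h * hu
    rw [← pow_add, ← pow_add, h1, h2, pow_mul, hζ, one_pow, pow_mul, hζ, one_pow]
  refine ⟨((s * g : ℕ) : F) ^ ((p ^ k - 1) * h) * (((-1) ^ (t - 1)) ^ h / (∏ j, γ j) ^ h),
    fun a => ?_⟩
  rw [prod_X_sub_C_cosetPoint hα hf,
    eval_derivative_prod_X_pow_sub_C γ (cosetPoint_pow hα a), mul_pow, mul_pow, mul_assoc]
  congr 1
  have hP := congrArg (· ^ h) (prod_sub_pow_of_pow_add_one_eq_one hγinj hγnorm a.1)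
  simp only [mul_pow, Fintype.card_fin] at hP
  rw [← pow_mul (γ a.1) 2, ← hh, hγnorm, mul_one, ← pow_mul, ← pow_mul] at hP
  have hβ : (cosetPoint ζ α t (s * g) a ^ (s * g - 1)) ^ ((p ^ k - 1) * h) = γ a.1 ^ (t * h) := by
    simp only [γ, cosetPoint]
    rw [← pow_mul, mul_pow, ← pow_mul, ← pow_mul,
      show (a.2 : ℕ) * ((s * g - 1) * ((p ^ k - 1) * h)) =
        (p ^ k - 1) * h * ((s * g - 1) * a.2) by ring,
      pow_mul α, hαh, one_pow, one_mul, mul_comm (a.1 : ℕ), pow_mul, hexp, pow_right_comm,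
      ← pow_mul, ← pow_mul, ← pow_mul]
    congr 1
    ring
  have hΓ : (∏ j, γ j) ^ h ≠ 0 := pow_ne_zero _ (Finset.prod_ne_zero_iff.2 fun j _ => hγ0 j)
  rw [hβ, eq_div_iff hΓ, ← hP]
  ring

end CosetUnion

theorem stmt_15 (r e f s t p k : ℕ) (hp : p.Prime) (hpodd : Odd p) (hr : r = p ^ k)
    (hk : 0 < k) (he : 0 < e) (hf : 0 < f) (heq : r ^ 2 - 1 = e * f)
    (hs : 0 < s) (hsf : s ∣ f) (hsr : s ∣ r - 1)
    (ht1 : 1 ≤ t) (ht2 : t ≤ s * (r + 1) / Nat.gcd (s * (r + 1)) f)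
    (htf : Even (t * f)) (heEven : Even e) (hcond : Even ((r - 1 + f * t) / s))
    (F : Type*) [Field F] [Fintype F] (hF : Fintype.card F = r ^ 2) :
    ∃ C : Submodule F (Fin (t * f) → F), IsMDSSelfDual C := by
  classical
  subst hr
  have hpfact : Fact p.Prime := ⟨hp⟩
  have hchar : CharP F p := charP_of_card_eq_prime_pow (by rw [hF, ← pow_mul])
  have hrodd : Odd (p ^ k) := hpodd.pow
  obtain ⟨h, hh⟩ : Even (p ^ k + 1) := hrodd.add_one
  rw [← two_mul] at hh
  have hfac : (p ^ k) ^ 2 - 1 = (p ^ k + 1) * (p ^ k - 1) := by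
    simpa using Nat.sq_sub_sq (p ^ k) 1
  have hpos : 0 < (p ^ k) ^ 2 - 1 := heq ▸ Nat.mul_pos he hf
  obtain ⟨ω, hω⟩ : ∃ ω : F, IsPrimitiveRoot ω ((p ^ k) ^ 2 - 1) := by
    obtain ⟨g, hg⟩ := IsCyclic.exists_ofOrder_eq_natCard (α := Fˣ)
    refine ⟨g, ?_⟩
    rw [← hF, ← Fintype.card_units, ← Nat.card_eq_fintype_card, ← hg, ← orderOf_units]
    exact IsPrimitiveRoot.orderOf _
  obtain ⟨w, hw⟩ := hsr
  have hα := hω.pow hpos heq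
  have hζ : IsPrimitiveRoot (ω ^ w) (s * (p ^ k + 1)) :=
    hω.pow hpos (by rw [hfac, hw]; ring)
  have ht : t ≤ orderOf ((ω ^ w) ^ f) := by
    rwa [orderOf_pow' _ hf.ne', ← hζ.eq_orderOf]
  have hαh : (ω ^ e) ^ ((p ^ k - 1) * h) = 1 := by
    obtain ⟨e', rfl⟩ := heEven
    rw [← pow_mul, show (e' + e') * ((p ^ k - 1) * h) = (p ^ k + 1) * (p ^ k - 1) * e' by
      rw [hh]; ring, ← hfac, pow_mul, hω.pow_eq_one, one_pow]
  have hcond' : 2 * s ∣ p ^ k - 1 + f * t := by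
    obtain ⟨c, hc⟩ := hcond
    have hdvd : s ∣ p ^ k - 1 + f * t := (Dvd.intro _ hw.symm).add (hsf.mul_right t)
    exact ⟨c, by rw [← Nat.div_mul_cancel hdvd, hc]; ring⟩
  obtain ⟨K, hK⟩ := exists_eval_derivative_cosetPoint_pow_eq hα hf ht hζ.pow_eq_one hh hsf
    hcond' hαh
  have hxinj : Function.Injective (cosetPoint (ω ^ w) (ω ^ e) t f) :=
    cosetPoint_injective hα (hζ.ne_zero (by positivity)) ht
  have hd0 : ∀ a, (Polynomial.derivative (∏ b, (Polynomial.X -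
      Polynomial.C (cosetPoint (ω ^ w) (ω ^ e) t f b)))).eval
        (cosetPoint (ω ^ w) (ω ^ e) t f a) ≠ 0 := fun a => by
    rw [← Lagrange.nodal_eq, Lagrange.eval_nodal_derivative_eval_node_eq (mem_univ a),
      Lagrange.eval_nodal]
    exact Finset.prod_ne_zero_iff.2 fun j hj =>
      sub_ne_zero.2 fun h => (Finset.mem_erase.1 hj).1 (hxinj h).symm
  have hN : Fintype.card F / 2 = (p ^ k - 1) * h := by
    have : (p ^ k) ^ 2 = 2 * ((p ^ k - 1) * h) + 1 := by
      rw [← Nat.sub_add_cancel (by omega : 1 ≤ (p ^ k) ^ 2), hfac, hh]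
      ring
    rw [hF]
    omega
  have hchar2 : ringChar F ≠ 2 := by
    rw [ringChar.eq F p]
    rintro rfl
    exact absurd hpodd (by decide)
  let a₀ : Fin t × Fin f := (⟨0, ht1⟩, ⟨0, hf⟩)
  refine exists_isMDSSelfDual_of_isSquare htf (Nat.mul_pos ht1 hf)
    (hxinj.comp finProdFinEquiv.symm.injective) (inv_ne_zero (hd0 a₀)) fun i => ?_
  have hprod := finProdFinEquiv.symm.prod_comp fun b : Fin t × Fin f =>
    (Polynomial.X - Polynomial.C (cosetPoint (ω ^ w) (ω ^ e) t f b))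
  simp only [Function.comp_apply]
  rw [hprod, FiniteField.isSquare_iff hchar2 (mul_ne_zero (inv_ne_zero (hd0 a₀)) (hd0 _)), hN,
    mul_pow, inv_pow, hK, hK, inv_mul_cancel₀]
  rw [← hK a₀]
  exact pow_ne_zero _ (hd0 a₀)
end
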